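/- arXiv:1803.10643 — 4 statements merged into one kernel-verified Lean document; each statement's English description precedes it below -/
import Mathlib

section
/- Suppose x_c ∈ X satisfies the stationarity conditions L'(x_c)(x_c) = 0 and L'(x_c)(x_d) = 0, and suppose x_d ∈ X_d satisfies the perturbed Galerkin equation L'(x_d)(y_d) = S(y_d) for all y_d ∈ X_d. Then, with e := x_c − x_d, for every y_d ∈ X_d there holds the error representation L(x_c) − L(x_d) = (1/2) L'(x_d)(x_c − y_d) + (1/2) S(y_d − x_d) + R, where the remainder is R = (1/2) ∫₀¹ L'''(x_d + s·e)(e, e, e) · s · (s − 1) ds. -/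
open intervalIntegral

/-- Along a line, the `n`-th directional derivative of a `C^(n+1)` function has the `(n+1)`-st
directional derivative as its derivative. -/
theorem hasDerivAt_iteratedFDeriv_line {X F : Type*} [NormedAddCommGroup X] [NormedSpace ℝ X]
    [NormedAddCommGroup F] [NormedSpace ℝ F] {f : X → F} {N : WithTop ℕ∞} (hf : ContDiff ℝ N f)
    {n : ℕ} (hn : (n : WithTop ℕ∞) < N) (x e : X) (s : ℝ) :
    HasDerivAt (fun t : ℝ => iteratedFDeriv ℝ n f (x + t • e) fun _ => e)
      (iteratedFDeriv ℝ (n + 1) f (x + s • e) fun _ => e) s := by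
  have hline : HasDerivAt (fun t : ℝ => x + t • e) e s := by
    simpa using ((hasDerivAt_id s).smul_const e).const_add x
  have hcomp := ((hf.differentiable_iteratedFDeriv hn) (x + s • e)).hasFDerivAt.comp_hasDerivAt s
    hline
  have happ := (ContinuousMultilinearMap.apply ℝ (fun _ : Fin n => X) F
    (fun _ => e)).hasFDerivAt.comp_hasDerivAt s hcomp
  rw [iteratedFDeriv_succ_apply_left]
  exact happ

/-- **Error representation via the Lagrangian functional** (Theorem 3.1).
Let `X` be a real normed space, `L : X → ℝ` three times continuously Fréchet
differentiable, `Xd ⊆ X` a (discrete) subspace and `S : X → ℝ` a given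
functional.  Suppose `x_c` satisfies the stationarity conditions
`L'(x_c)(x_c) = 0` and `L'(x_c)(x_d) = 0`, and `x_d ∈ Xd` satisfies the
perturbed Galerkin equation `L'(x_d)(y_d) = S(y_d)` for all `y_d ∈ Xd`.
Then, with `e := x_c − x_d`, for every `y_d ∈ Xd`
`L(x_c) − L(x_d) = ½ L'(x_d)(x_c − y_d) + ½ S(y_d − x_d) + R`,
where `R = ½ ∫₀¹ L'''(x_d + s e)(e,e,e) · s · (s−1) ds`. -/
theorem lagrangian_error_representation
    {X : Type*} [NormedAddCommGroup X] [NormedSpace ℝ X]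
    (L : X → ℝ) (hL : ContDiff ℝ 3 L)
    (Xd : Submodule ℝ X) (S : X → ℝ)
    (x_c x_d : X) (hxd : x_d ∈ Xd)
    (hstat_c : fderiv ℝ L x_c x_c = 0)
    (hstat_d : fderiv ℝ L x_c x_d = 0)
    (hGalerkin : ∀ y_d ∈ Xd, fderiv ℝ L x_d y_d = S y_d) :
    ∀ y_d ∈ Xd,
      L x_c - L x_d =
        (1 / 2) * fderiv ℝ L x_d (x_c - y_d) + (1 / 2) * S (y_d - x_d) +
          (1 / 2) * ∫ s in (0:ℝ)..1,
            (iteratedFDeriv ℝ 3 L (x_d + s • (x_c - x_d)) fun _ => x_c - x_d)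
              * s * (s - 1) := by
  intro y_d hyd
  set e := x_c - x_d with he
  have hend : x_d + (1 : ℝ) • e = x_c := by simp [he]
  have h0 := hasDerivAt_iteratedFDeriv_line hL (n := 0) (by norm_num) x_d e
  have h1 := hasDerivAt_iteratedFDeriv_line hL (n := 1) (by norm_num) x_d e
  have h2 := hasDerivAt_iteratedFDeriv_line hL (n := 2) (by norm_num) x_d e
  simp only [Nat.reduceAdd, iteratedFDeriv_zero_apply, iteratedFDeriv_one_apply] at h0 h1 h2
  have hcont : Continuous fun s : ℝ => iteratedFDeriv ℝ 3 L (x_d + s • e) fun _ => e :=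
    (ContinuousMultilinearMap.apply ℝ (fun _ : Fin 3 => X) ℝ (fun _ => e)).continuous.comp
      ((hL.continuous_iteratedFDeriv (m := 3) (by norm_num)).comp (by fun_prop))
  have hderiv : ∀ s : ℝ, HasDerivAt
      (fun t : ℝ => (iteratedFDeriv ℝ 2 L (x_d + t • e) fun _ => e) * (t * (t - 1))
        - fderiv ℝ L (x_d + t • e) e * (2 * t - 1) + 2 * L (x_d + t • e))
      ((iteratedFDeriv ℝ 3 L (x_d + s • e) fun _ => e) * s * (s - 1)) s := by
    intro s
    have hid := hasDerivAt_id' s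
    refine HasDerivAt.congr_deriv ((((h2 s).mul (hid.mul (hid.sub_const 1))).sub
      ((h1 s).mul ((hid.const_mul 2).sub_const 1))).add ((h0 s).const_mul 2)) ?_
    simp only [Pi.mul_apply]
    ring
  rw [integral_eq_sub_of_hasDerivAt (fun s _ => hderiv s)
    (((hcont.mul continuous_id).mul (continuous_id.sub continuous_const)).intervalIntegrable _ _),
    ← hGalerkin _ (Xd.sub_mem hyd hxd), hend]
  have hstat : fderiv ℝ L x_c e = 0 := by rw [he, map_sub, hstat_c, hstat_d, sub_zero]
  have hsplit : fderiv ℝ L x_d e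
      = fderiv ℝ L x_d (x_c - y_d) + fderiv ℝ L x_d (y_d - x_d) := by
    rw [← map_add, he, sub_add_sub_cancel]
  simp only [hstat, zero_smul, add_zero, hsplit]
  ring
end

section
/- Assume J is twice continuously differentiable. Then for all ψ_h, φ_h ∈ V_h there holds ρ*(z_h)(u − ψ_h) = ρ(u_h)(z − φ_h) + S(u_h)(φ_h − z_h) + S*(z_h)(u_h − ψ_h) + Δρ_J, where, with e := u − u_h, the remainder is Δρ_J := −∫₀¹ J''(u_h + s·e)(e, e) ds. -/
open intervalIntegral

/-- The first derivative of a `C²` function increases along a segment by the integral of the second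
derivative. -/
theorem integral_iteratedFDeriv_two_segment {V : Type*} [NormedAddCommGroup V] [NormedSpace ℝ V]
    {J : V → ℝ} (hJ : ContDiff ℝ 2 J) (x e : V) :
    ∫ s in (0:ℝ)..1, (iteratedFDeriv ℝ 2 J (x + s • e) fun _ => e) =
      fderiv ℝ J (x + e) e - fderiv ℝ J x e := by
  have hJ' : ContDiff ℝ 1 (fderiv ℝ J) := hJ.fderiv_right (by norm_num)
  have hline (s : ℝ) : HasDerivAt (fun s : ℝ => x + s • e) e s := by
    simpa using ((hasDerivAt_id s).smul_const e).const_add x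
  have hderiv (s : ℝ) : HasDerivAt (fun s : ℝ => fderiv ℝ J (x + s • e) e)
      (fderiv ℝ (fderiv ℝ J) (x + s • e) e e) s := by
    have h := (hJ'.differentiable one_ne_zero (x + s • e)).hasFDerivAt.comp_hasDerivAt s (hline s)
    simpa using h.clm_apply (hasDerivAt_const s e)
  have hcont : Continuous fun s : ℝ => fderiv ℝ (fderiv ℝ J) (x + s • e) e e := by
    have h := hJ'.continuous_fderiv one_ne_zero
    fun_prop
  simp only [iteratedFDeriv_two_apply]
  rw [integral_eq_sub_of_hasDerivAt (fun s _ => hderiv s) (hcont.intervalIntegrable 0 1)]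
  simp

/-- **Dual residual equals primal residual up to stabilization terms and a
quadratic remainder** (Theorem 3.3).  Under the setting of the DWR method
with SUPG stabilization: for all `ψ_h, φ_h ∈ Vh`,
`ρ*(z_h)(u − ψ_h) = ρ(u_h)(z − φ_h) + S(u_h)(φ_h − z_h) + S*(z_h)(u_h − ψ_h) + Δρ_J`,
where, with `e := u − u_h`, `Δρ_J := − ∫₀¹ J''(u_h + s e)(e,e) ds`. -/
theorem dual_residual_vs_primal_residual
    {V : Type*} [NormedAddCommGroup V] [NormedSpace ℝ V]
    (A : V →L[ℝ] V →L[ℝ] ℝ) (F : V →L[ℝ] ℝ)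
    (J : V → ℝ) (hJ : ContDiff ℝ 2 J)
    (Vh : Submodule ℝ V) (S Sstar : V → V →ₗ[ℝ] ℝ)
    (u z uh zh : V) (huh : uh ∈ Vh) (hzh : zh ∈ Vh)
    (hprimal : ∀ φ : V, A u φ = F φ)
    (hdual : ∀ ψ : V, A ψ z = fderiv ℝ J u ψ)
    (hprimal_h : ∀ φh ∈ Vh, A uh φh + S uh φh = F φh)
    (hdual_h : ∀ ψh ∈ Vh, A ψh zh + Sstar zh ψh = fderiv ℝ J uh ψh) :
    ∀ ψh ∈ Vh, ∀ φh ∈ Vh,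
      fderiv ℝ J uh (u - ψh) - A (u - ψh) zh =
        (F (z - φh) - A uh (z - φh)) + S uh (φh - zh) + Sstar zh (uh - ψh) +
          (- ∫ s in (0:ℝ)..1,
              (iteratedFDeriv ℝ 2 J (uh + s • (u - uh)) fun _ => u - uh)) := by
  intro ψh hψ φh hφ
  rw [integral_iteratedFDeriv_two_segment hJ, add_sub_cancel]
  have hS := hprimal_h (φh - zh) (Vh.sub_mem hφ hzh)
  have hSstar := hdual_h (uh - ψh) (Vh.sub_mem huh hψ)
  have hu := hprimal (z - zh)
  have hz := hdual (u - uh)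
  simp only [map_sub, sub_apply] at hS hSstar hu hz ⊢
  linarith
end

section
/- Assume J is twice continuously differentiable. Then for every ψ_h ∈ V_h there holds ρ*(z_h)(u − ψ_h) = A*(z − z_h)(u − u_h) + S*(z_h)(u_h − ψ_h) + Δρ_J, where, with e := u − u_h, the remainder is Δρ_J := −∫₀¹ J''(u_h + s·e)(e, e) ds. -/
open intervalIntegral

/-- **Dual residual in terms of the adjoint form of the errors.**  With
`ρ*(z_h)(ψ) := J'(u_h)(ψ) − A*(z_h)(ψ)`, `A*(z)(ψ) := A(ψ)(z)`, exact dual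
solution `z` with `A*(z)(ψ) = J'(u)(ψ)` for all `ψ`, and discrete stabilized
dual solution `z_h ∈ Vh`, one has for every `ψ_h ∈ Vh`, with `e := u − u_h`:
`ρ*(z_h)(u − ψ_h) = A*(z − z_h)(u − u_h) + S*(z_h)(u_h − ψ_h) + Δρ_J`,
where `Δρ_J := − ∫₀¹ J''(u_h + s e)(e,e) ds`. -/
theorem dual_residual_adjoint_form
    {V : Type*} [NormedAddCommGroup V] [NormedSpace ℝ V]
    (A : V →L[ℝ] V →L[ℝ] ℝ)
    (J : V → ℝ) (hJ : ContDiff ℝ 2 J)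
    (Vh : Submodule ℝ V) (Sstar : V → V →ₗ[ℝ] ℝ)
    (u z uh zh : V) (huh : uh ∈ Vh) (hzh : zh ∈ Vh)
    (hdual : ∀ ψ : V, A ψ z = fderiv ℝ J u ψ)
    (hdual_h : ∀ ψh ∈ Vh, A ψh zh + Sstar zh ψh = fderiv ℝ J uh ψh) :
    ∀ ψh ∈ Vh,
      fderiv ℝ J uh (u - ψh) - A (u - ψh) zh =
        A (u - uh) (z - zh) + Sstar zh (uh - ψh) +
          (- ∫ s in (0:ℝ)..1,
              (iteratedFDeriv ℝ 2 J (uh + s • (u - uh)) fun _ => u - uh)) := by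
  intro ψh hψh
  have hsplit : u - ψh = (u - uh) + (uh - ψh) := by abel
  have hgal := hdual_h (uh - ψh) (Vh.sub_mem huh hψh)
  have hex := hdual (u - uh)
  rw [integral_iteratedFDeriv_two_segment hJ, add_sub_cancel, hsplit]
  simp only [map_add, add_apply, map_sub (A (u - uh))]
  linarith
end

section
/- For every φ_h ∈ V_h there holds A*(z − z_h)(u − u_h) = ρ(u_h)(z − φ_h) + S(u_h)(φ_h − z_h). -/
/-- **Adjoint form of the errors equals the weighted primal residual plus a
stabilization term.**  With `A*(z)(ψ) := A(ψ)(z)`, the primal residual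
`ρ(u_h)(φ) := F(φ) − A(u_h)(φ)`, exact primal solution `u` with
`A(u)(φ) = F(φ)` for all `φ`, and discrete stabilized primal solution
`u_h ∈ Vh` with `A(u_h)(φ_h) + S(u_h)(φ_h) = F(φ_h)` for all `φ_h ∈ Vh`, one
has for every `φ_h ∈ Vh`:
`A*(z − z_h)(u − u_h) = ρ(u_h)(z − φ_h) + S(u_h)(φ_h − z_h)`. -/
theorem adjoint_error_form_eq_primal_residual
    {V : Type*} [NormedAddCommGroup V] [NormedSpace ℝ V]
    (A : V →L[ℝ] V →L[ℝ] ℝ) (F : V →L[ℝ] ℝ)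
    (Vh : Submodule ℝ V) (S : V → V →ₗ[ℝ] ℝ)
    (u z uh zh : V) (huh : uh ∈ Vh) (hzh : zh ∈ Vh)
    (hprimal : ∀ φ : V, A u φ = F φ)
    (hprimal_h : ∀ φh ∈ Vh, A uh φh + S uh φh = F φh) :
    ∀ φh ∈ Vh,
      A (u - uh) (z - zh) = (F (z - φh) - A uh (z - φh)) + S uh (φh - zh) := by
  intro φh hφh
  simp only [map_sub, sub_apply, hprimal]
  linarith [hprimal_h φh hφh, hprimal_h zh hzh]
end
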